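/- Let (a_t, m_t) be a scheduler pair such that a_t/m_t is strictly monotonically increasing on (0,1) and ‖a‖_{1,∞} ≤ M, ‖m‖_{1,∞} ≤ M for some M ≥ 1, and suppose the kinetic energy E(a,m) = ∫₀¹ (ȧ_t² + ṁ_t²) dt − ∫₀¹ β_t² (1 − λ(a_t/m_t)) dt is finite. Then the Cond-OT scheduler (a_t, m_t) = (t, 1−t) satisfies E(Cond-OT) ≤ E(a,m) + 6 M² n / √d; in particular Cond-OT is asymptotically kinetic optimal as n/√d → 0. (Corollary 4.4 of the paper.) -/

import Mathlib

open MeasureTheory ProbabilityTheory Real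

/-- Standard Gaussian measure `N(0, I_d)` on `ℝ^d`. -/
noncomputable def stdGaussian (d : ℕ) : Measure (EuclideanSpace ℝ (Fin d)) :=
  (Measure.pi fun _ : Fin d => gaussianReal 0 1).map (EuclideanSpace.equiv (Fin d) ℝ).symm

/-- Softmax posterior weights `ρ_s(x_i | y)`. -/
noncomputable def rho (d n : ℕ) (s : ℝ) (x : Fin n → EuclideanSpace ℝ (Fin d))
    (i : Fin n) (y : EuclideanSpace ℝ (Fin d)) : ℝ :=
  Real.exp (-(s ^ 2 / 2) * ‖x i - y‖ ^ 2) / ∑ l, Real.exp (-(s ^ 2 / 2) * ‖x l - y‖ ^ 2)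

/-- The data separation function `λ(s)`. -/
noncomputable def lamSep (d n : ℕ) (x : Fin n → EuclideanSpace ℝ (Fin d)) (s : ℝ) : ℝ :=
  (1 / ((d : ℝ) * n)) *
    ∑ j, ∫ z, ‖∑ i, rho d n s x i (x j + s⁻¹ • z) • x i‖ ^ 2 ∂ stdGaussian d

/-- The kinetic energy of the Gaussian path with scheduler `(a, m)`:
`E(a,m) = ∫₀¹ (ȧ_t² + ṁ_t²) dt − ∫₀¹ β_t² (1 − λ(a_t/m_t)) dt`. -/
noncomputable def KE (d n : ℕ) (x : Fin n → EuclideanSpace ℝ (Fin d)) (a m : ℝ → ℝ) : ℝ :=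
  (∫ t in (0 : ℝ)..1, ((deriv a t) ^ 2 + (deriv m t) ^ 2)) -
    ∫ t in (0 : ℝ)..1,
      (deriv a t - a t * deriv m t / m t) ^ 2 * (1 - lamSep d n x (a t / m t))


lemma aux_pi_gauss (d : ℕ) : (Measure.pi fun _ : Fin d => gaussianReal 0 1) =
    (volume : Measure (Fin d → ℝ)).withDensity
      (fun z => ENNReal.ofReal (∏ i, gaussianPDFReal 0 1 (z i))) := by
  have hint : Integrable (fun z : Fin d → ℝ => ∏ i, gaussianPDFReal 0 1 (z i)) := by
    exact Integrable.fintype_prod (f := fun _ : Fin d => gaussianPDFReal 0 1)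
      (fun _ => integrable_gaussianPDFReal 0 1)
  refine Measure.pi_eq fun s hs => ?_
  rw [withDensity_apply _ (MeasurableSet.univ_pi hs),
    ← ofReal_integral_eq_lintegral_ofReal hint.integrableOn
      (Filter.Eventually.of_forall fun z => Finset.prod_nonneg fun i _ =>
        gaussianPDFReal_nonneg 0 1 (z i)), volume_pi, Measure.restrict_pi_pi,
    integral_fintype_prod_eq_prod (f := fun _ : Fin d => gaussianPDFReal 0 1),
    ENNReal.ofReal_prod_of_nonneg]
  · refine Finset.prod_congr rfl fun i _ => ?_
    rw [gaussianReal_apply_eq_integral _ one_ne_zero]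
  · intro i _
    exact integral_nonneg fun z => gaussianPDFReal_nonneg 0 1 z

/-- Gaussian density up to constant. -/
lemma aux_density (d : ℕ) (z : Fin d → ℝ) : ∏ i, gaussianPDFReal 0 1 (z i) =
    ((√(2 * π))⁻¹) ^ d * Real.exp (-(‖(WithLp.toLp 2 z : EuclideanSpace ℝ (Fin d))‖ ^ 2) / 2) := by
  simp only [gaussianPDFReal, Finset.prod_mul_distrib, Finset.prod_const, Finset.card_univ,
    Fintype.card_fin, ← Real.exp_sum, EuclideanSpace.real_norm_sq_eq]
  simp [← Finset.sum_div, neg_div]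

lemma aux_stdGaussian (d : ℕ) : _root_.stdGaussian d =
    (volume : Measure (EuclideanSpace ℝ (Fin d))).withDensity
      (fun z => ENNReal.ofReal (((√(2 * π))⁻¹) ^ d * Real.exp (-(‖z‖ ^ 2) / 2))) := by
  have hmp := PiLp.volume_preserving_toLp (Fin d)
  have : _root_.stdGaussian d =
    (Measure.pi fun _ : Fin d => gaussianReal 0 1).map (MeasurableEquiv.toLp 2 (Fin d → ℝ)) := rfl
  rw [this, aux_pi_gauss]
  ext S hS
  rw [Measure.map_apply (MeasurableEquiv.measurable _) hS, withDensity_apply _ hS,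
    withDensity_apply _ (MeasurableEquiv.measurable _ hS),
    ← hmp.setLIntegral_comp_preimage hS (by fun_prop)]
  simp only [aux_density]
  rfl

instance aux_prob (d : ℕ) : IsProbabilityMeasure (_root_.stdGaussian d) := by
  unfold _root_.stdGaussian
  exact Measure.isProbabilityMeasure_map (by fun_prop)

/-- the Gaussian density -/
noncomputable def gphi (d : ℕ) (z : EuclideanSpace ℝ (Fin d)) : ℝ :=
  ((√(2 * π))⁻¹) ^ d * Real.exp (-(‖z‖ ^ 2) / 2)

lemma gphi_pos (d : ℕ) (z : EuclideanSpace ℝ (Fin d)) : 0 < gphi d z := by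
  unfold gphi; positivity

lemma gphi_cont (d : ℕ) : Continuous (gphi d) := by
  unfold gphi; fun_prop

lemma aux_integral (d : ℕ) (F : EuclideanSpace ℝ (Fin d) → ℝ) :
    ∫ z, F z ∂(_root_.stdGaussian d) = ∫ z, gphi d z * F z := by
  rw [aux_stdGaussian, integral_withDensity_eq_integral_toReal_smul (by fun_prop)
    (Filter.Eventually.of_forall fun z => ENNReal.ofReal_lt_top)]
  refine integral_congr_ae (Filter.Eventually.of_forall fun z => ?_)
  simp only [smul_eq_mul]
  change (ENNReal.ofReal (gphi d z)).toReal * F z = _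
  rw [ENNReal.toReal_ofReal (gphi_pos d z).le]

lemma gphi_integral (d : ℕ) : ∫ z, gphi d z = 1 := by
  have := aux_integral d (fun _ => 1)
  simpa using this.symm

lemma gphi_integrable (d : ℕ) : Integrable (gphi d) := by
  by_contra h
  have := gphi_integral d
  rw [integral_undef h] at this
  norm_num at this

lemma gphi_integral_shift (d : ℕ) (v) : ∫ z, gphi d (z - v) = 1 := by
  rw [integral_sub_right_eq_self (gphi d), gphi_integral]

lemma gphi_mid (d : ℕ) (w u v : EuclideanSpace ℝ (Fin d)) :
    gphi d (w - u) * gphi d (w - v) =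
      (gphi d (w - (2⁻¹ : ℝ) • (u + v)) * Real.exp (-(‖u - v‖ ^ 2) / 8)) ^ 2 := by
  have h := parallelogram_law_with_norm ℝ (w - u) (w - v)
  have e1 : (w - u) + (w - v) = (2 : ℝ) • (w - (2⁻¹ : ℝ) • (u + v)) := by
    module
  have e2 : (w - u) - (w - v) = v - u := by abel
  rw [e1, e2, norm_smul, norm_sub_rev v u] at h
  unfold gphi
  rw [mul_assoc _ (rexp _) (rexp (-(‖u - v‖ ^ 2) / 8)), ← Real.exp_add, mul_pow,
    ← Real.exp_nat_mul, mul_mul_mul_comm, ← Real.exp_add, ← pow_two]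
  congr 2
  norm_num at h ⊢
  nlinarith

lemma aux_variance {d n : ℕ} (x : Fin n → EuclideanSpace ℝ (Fin d)) (p : Fin n → ℝ) (q : ℝ)
    (hq : q = ∑ i, p i) (hq0 : 0 < q) :
    ∑ j, p j * (‖x j‖ ^ 2 - ‖∑ i, (p i / q) • x i‖ ^ 2) =
      ∑ i, ∑ j, (p i * p j / q) * (‖x i - x j‖ ^ 2 / 2) := by
  have h1 : ‖∑ i, (p i / q) • x i‖ ^ 2 = ∑ i, ∑ j, (p i / q) * (p j / q) * inner ℝ (x i) (x j) := by
    rw [← real_inner_self_eq_norm_sq, sum_inner]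
    refine Finset.sum_congr rfl fun i _ => ?_
    rw [inner_sum]
    refine Finset.sum_congr rfl fun j _ => ?_
    rw [real_inner_smul_left, real_inner_smul_right]; ring
  have h2 : ∑ i, ∑ j, (p i * p j / q) * (‖x i - x j‖ ^ 2 / 2) =
      ∑ i, ∑ j, (p i * p j / q) * (‖x i‖ ^ 2 / 2) + ∑ i, ∑ j, (p i * p j / q) * (‖x j‖ ^ 2 / 2)
        - ∑ i, ∑ j, (p i * p j / q) * inner ℝ (x i) (x j) := by
    simp only [← Finset.sum_add_distrib, ← Finset.sum_sub_distrib]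
    refine Finset.sum_congr rfl fun i _ => Finset.sum_congr rfl fun j _ => ?_
    rw [norm_sub_sq_real]; ring
  have h3 : ∑ i, ∑ j, (p i * p j / q) * (‖x i‖ ^ 2 / 2) = ∑ j, p j * (‖x j‖ ^ 2 / 2) := by
    refine Finset.sum_congr rfl fun i _ => ?_
    rw [← Finset.sum_mul, ← Finset.sum_div, ← Finset.mul_sum, ← hq]
    field_simp
  have h4 : ∑ i, ∑ j, (p i * p j / q) * (‖x j‖ ^ 2 / 2) = ∑ j, p j * (‖x j‖ ^ 2 / 2) := by
    rw [Finset.sum_comm, ← h3]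
    refine Finset.sum_congr rfl fun i _ => Finset.sum_congr rfl fun j _ => ?_
    rw [mul_comm (p i)]
  have h5 : q * ‖∑ i, (p i / q) • x i‖ ^ 2 = ∑ i, ∑ j, (p i * p j / q) * inner ℝ (x i) (x j) := by
    rw [h1, Finset.mul_sum]
    refine Finset.sum_congr rfl fun i _ => ?_
    rw [Finset.mul_sum]
    refine Finset.sum_congr rfl fun j _ => ?_
    field_simp
  rw [h2, h3, h4, ← h5]
  simp only [mul_sub, Finset.sum_sub_distrib]
  rw [← Finset.sum_mul, ← hq]
  congr 1
  rw [← Finset.sum_add_distrib]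
  refine Finset.sum_congr rfl fun i _ => ?_
  ring

/-- posterior mean in rescaled coordinates -/
noncomputable def pmean (d n : ℕ) (x : Fin n → EuclideanSpace ℝ (Fin d)) (s : ℝ)
    (w : EuclideanSpace ℝ (Fin d)) : EuclideanSpace ℝ (Fin d) :=
  ∑ i, (gphi d (w - s • x i) / ∑ l, gphi d (w - s • x l)) • x i

lemma rho_eq (d n : ℕ) (x : Fin n → EuclideanSpace ℝ (Fin d)) {s : ℝ} (hs : 0 < s)
    (i j : Fin n) (z : EuclideanSpace ℝ (Fin d)) :
    rho d n s x i (x j + s⁻¹ • z) =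
      gphi d (z + s • x j - s • x i) / ∑ l, gphi d (z + s • x j - s • x l) := by
  have key : ∀ l, gphi d (z + s • x j - s • x l) =
      ((√(2 * π))⁻¹) ^ d * Real.exp (-(s ^ 2 / 2) * ‖x l - (x j + s⁻¹ • z)‖ ^ 2) := by
    intro l
    have : z + s • x j - s • x l = (-s) • (x l - (x j + s⁻¹ • z)) := by
      rw [neg_smul, smul_sub, smul_add, smul_smul, mul_inv_cancel₀ hs.ne', one_smul]; abel
    rw [gphi, this, norm_smul, mul_pow]
    congr 2
    simp only [norm_neg, Real.norm_eq_abs, sq_abs]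
    ring
  simp only [key, ← Finset.mul_sum]
  rw [mul_div_mul_left _ _ (by positivity)]
  rfl

lemma gsum_pos (d n : ℕ) (hn : 1 ≤ n) (x : Fin n → EuclideanSpace ℝ (Fin d)) (s : ℝ)
    (w : EuclideanSpace ℝ (Fin d)) : 0 < ∑ l, gphi d (w - s • x l) := by
  have : Nonempty (Fin n) := ⟨⟨0, hn⟩⟩
  exact Finset.sum_pos (fun l _ => gphi_pos d _) Finset.univ_nonempty

lemma pmean_cont (d n : ℕ) (hn : 1 ≤ n) (x : Fin n → EuclideanSpace ℝ (Fin d)) (s : ℝ) :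
    Continuous (pmean d n x s) := by
  have := gphi_cont d
  unfold pmean
  refine continuous_finsetSum _ fun i _ => ?_
  have hc : Continuous (fun w => gphi d (w - s • x i) / ∑ l, gphi d (w - s • x l)) := by
    refine Continuous.div₀ ?_ ?_ ?_
    · fun_prop
    · fun_prop
    · intro w; exact (gsum_pos d n hn x s w).ne'
  exact hc.smul continuous_const

lemma pmean_bound (d n : ℕ) (hn : 1 ≤ n) (x : Fin n → EuclideanSpace ℝ (Fin d)) (s : ℝ) (w) :
    ‖pmean d n x s w‖ ≤ ∑ i, ‖x i‖ := by
  refine (norm_sum_le _ _).trans (Finset.sum_le_sum fun i _ => ?_)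
  rw [norm_smul]
  refine mul_le_of_le_one_left (norm_nonneg _) ?_
  rw [Real.norm_eq_abs, abs_of_nonneg (div_nonneg (gphi_pos d _).le (gsum_pos d n hn x s w).le),
    div_le_one (gsum_pos d n hn x s w)]
  exact Finset.single_le_sum (f := fun l => gphi d (w - s • x l)) (fun l _ => (gphi_pos d _).le)
    (Finset.mem_univ i)

lemma int_pm (d n : ℕ) (hn : 1 ≤ n) (x : Fin n → EuclideanSpace ℝ (Fin d)) (s : ℝ) (v) :
    Integrable (fun w => gphi d (w - v) * ‖pmean d n x s w‖ ^ 2) := by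
  have h := (gphi_integrable d).comp_sub_right v
  refine h.mul_bdd (c := (∑ i, ‖x i‖) ^ 2)
    (((pmean_cont d n hn x s).norm.pow 2).aestronglyMeasurable)
    (Filter.Eventually.of_forall fun w => ?_)
  rw [Real.norm_eq_abs, abs_of_nonneg (by positivity)]
  exact pow_le_pow_left₀ (norm_nonneg _) (pmean_bound d n hn x s w) 2

lemma one_sub_lam (d n : ℕ) (hn : 1 ≤ n) (x : Fin n → EuclideanSpace ℝ (Fin d))
    (hvar : 1 / ((d : ℝ) * n) * ∑ i, ‖x i‖ ^ 2 = 1) {s : ℝ} (hs : 0 < s) :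
    1 - lamSep d n x s = 1 / ((d : ℝ) * n) *
      ∫ w, ∑ j, gphi d (w - s • x j) * (‖x j‖ ^ 2 - ‖pmean d n x s w‖ ^ 2) := by
  have h1 : ∀ j, ∫ z, ‖∑ i, rho d n s x i (x j + s⁻¹ • z) • x i‖ ^ 2 ∂ _root_.stdGaussian d =
      ∫ w, gphi d (w - s • x j) * ‖pmean d n x s w‖ ^ 2 := by
    intro j
    rw [aux_integral, ← integral_add_right_eq_self
      (fun w => gphi d (w - s • x j) * ‖pmean d n x s w‖ ^ 2) (s • x j)]
    simp only [add_sub_cancel_right, pmean, rho_eq d n x hs]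
  unfold lamSep
  simp only [h1]
  rw [integral_finsetSum]
  · have h2 : ∀ j, ∫ w, gphi d (w - s • x j) * (‖x j‖ ^ 2 - ‖pmean d n x s w‖ ^ 2) =
        ‖x j‖ ^ 2 - ∫ w, gphi d (w - s • x j) * ‖pmean d n x s w‖ ^ 2 := by
      intro j
      simp only [mul_sub]
      rw [integral_sub (((gphi_integrable d).comp_sub_right _).mul_const _) (int_pm d n hn x s _),
        integral_mul_const, gphi_integral_shift, one_mul]
    simp only [h2]
    rw [Finset.sum_sub_distrib, mul_sub, hvar]
  · intro j _
    simp only [mul_sub]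
    exact (((gphi_integrable d).comp_sub_right _).mul_const _).sub (int_pm d n hn x s _)

lemma pt_nonneg (d n : ℕ) (hn : 1 ≤ n) (x : Fin n → EuclideanSpace ℝ (Fin d)) (s : ℝ) (w) :
    0 ≤ ∑ j, gphi d (w - s • x j) * (‖x j‖ ^ 2 - ‖pmean d n x s w‖ ^ 2) := by
  unfold pmean
  rw [aux_variance x (fun i => gphi d (w - s • x i)) _ rfl (gsum_pos d n hn x s w)]
  refine Finset.sum_nonneg fun i _ => Finset.sum_nonneg fun j _ => ?_
  have h1 := (gphi_pos d (w - s • x i)).le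
  have h2 := (gphi_pos d (w - s • x j)).le
  have h3 := (gsum_pos d n hn x s w).le
  exact mul_nonneg (div_nonneg (mul_nonneg h1 h2) h3) (div_nonneg (sq_nonneg _) zero_le_two)

lemma pt_le (d n : ℕ) (hn : 1 ≤ n) (x : Fin n → EuclideanSpace ℝ (Fin d)) (s : ℝ) (w) :
    ∑ j, gphi d (w - s • x j) * (‖x j‖ ^ 2 - ‖pmean d n x s w‖ ^ 2) ≤
    ∑ i, ∑ j, gphi d (w - (2⁻¹ : ℝ) • (s • x i + s • x j)) *
      (Real.exp (-(‖x i - x j‖ ^ 2 / 8) * s ^ 2) * (‖x i - x j‖ ^ 2 / 2)) := by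
  unfold pmean
  rw [aux_variance x (fun i => gphi d (w - s • x i)) _ rfl (gsum_pos d n hn x s w)]
  refine Finset.sum_le_sum fun i _ => Finset.sum_le_sum fun j _ => ?_
  rw [← mul_assoc]
  refine mul_le_mul_of_nonneg_right ?_ (by positivity)
  have hq := gsum_pos d n hn x s w
  rw [div_le_iff₀ hq]
  have hi := Finset.single_le_sum (f := fun l => gphi d (w - s • x l))
    (fun l _ => (gphi_pos d _).le) (Finset.mem_univ i)
  have hj := Finset.single_le_sum (f := fun l => gphi d (w - s • x l))
    (fun l _ => (gphi_pos d _).le) (Finset.mem_univ j)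
  have h := gphi_mid d w (s • x i) (s • x j)
  have e : rexp (-(‖s • x i - s • x j‖ ^ 2) / 8) = rexp (-(‖x i - x j‖ ^ 2 / 8) * s ^ 2) := by
    rw [← smul_sub, norm_smul, mul_pow, Real.norm_eq_abs, sq_abs]; congr 1; ring
  rw [e] at h
  rw [h, pow_two]
  refine mul_le_mul_of_nonneg_left ?_ (mul_nonneg (gphi_pos d _).le (Real.exp_pos _).le)
  refine le_of_sq_le_sq ?_ hq.le
  rw [← h, pow_two]
  exact mul_le_mul hi hj (gphi_pos d _).le hq.le

lemma lam_bounds (d n : ℕ) (hn : 1 ≤ n) (x : Fin n → EuclideanSpace ℝ (Fin d))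
    (hvar : 1 / ((d : ℝ) * n) * ∑ i, ‖x i‖ ^ 2 = 1) {s : ℝ} (hs : 0 < s) :
    0 ≤ 1 - lamSep d n x s ∧ 1 - lamSep d n x s ≤ 1 / ((d : ℝ) * n) *
      ∑ i, ∑ j, Real.exp (-(‖x i - x j‖ ^ 2 / 8) * s ^ 2) * (‖x i - x j‖ ^ 2 / 2) := by
  rw [one_sub_lam d n hn x hvar hs]
  constructor
  · exact mul_nonneg (by positivity) (integral_nonneg (pt_nonneg d n hn x s))
  · refine mul_le_mul_of_nonneg_left ?_ (by positivity)
    have hI : ∀ i j, Integrable (fun w => gphi d (w - (2⁻¹ : ℝ) • (s • x i + s • x j)) *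
      (Real.exp (-(‖x i - x j‖ ^ 2 / 8) * s ^ 2) * (‖x i - x j‖ ^ 2 / 2))) := fun i j =>
      ((gphi_integrable d).comp_sub_right _).mul_const _
    have hI1 : Integrable (fun w => ∑ i, ∑ j, gphi d (w - (2⁻¹ : ℝ) • (s • x i + s • x j)) *
      (Real.exp (-(‖x i - x j‖ ^ 2 / 8) * s ^ 2) * (‖x i - x j‖ ^ 2 / 2))) :=
      integrable_finsetSum _ fun i _ => integrable_finsetSum _ fun j _ => hI i j
    refine (integral_mono_of_nonneg (Filter.Eventually.of_forall (pt_nonneg d n hn x s)) hI1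
      (Filter.Eventually.of_forall (pt_le d n hn x s))).trans (le_of_eq ?_)
    rw [integral_finsetSum _ fun i _ => integrable_finsetSum _ fun j _ => hI i j]
    refine Finset.sum_congr rfl fun i _ => ?_
    rw [integral_finsetSum _ fun j _ => hI i j]
    refine Finset.sum_congr rfl fun j _ => ?_
    rw [integral_mul_const, gphi_integral_shift, one_mul]

lemma gauss_prim (D s : ℝ) (hD : 0 ≤ D) (hs : 0 ≤ s) :
    D ^ 2 / 2 * ∫ u in (0 : ℝ)..s, Real.exp (-(D ^ 2 / 8) * u ^ 2) ≤ 2 * D := by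
  rcases hD.eq_or_lt with rfl | hD
  · simp
  have hb : 0 < D ^ 2 / 8 := by positivity
  have h1 : ∫ u in (0 : ℝ)..s, Real.exp (-(D ^ 2 / 8) * u ^ 2) ≤ √(π / (D ^ 2 / 8)) / 2 := by
    rw [← integral_gaussian_Ioi, intervalIntegral.integral_of_le hs]
    exact setIntegral_mono_set (integrable_exp_neg_mul_sq hb).integrableOn
      (Filter.Eventually.of_forall fun u => (Real.exp_pos _).le)
      (Filter.Eventually.of_forall fun u hu => hu.1)
  have h2 : √(π / (D ^ 2 / 8)) ≤ 8 / D := by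
    rw [Real.sqrt_le_left (by positivity), div_pow, div_div_eq_mul_div]
    have := Real.pi_lt_four
    gcongr
    linarith
  calc _ ≤ D ^ 2 / 2 * ((8 / D) / 2) := by
        gcongr; linarith
    _ = 2 * D := by field_simp; norm_num

lemma sum_dist (d n : ℕ) (hd : 1 ≤ d) (hn : 1 ≤ n) (x : Fin n → EuclideanSpace ℝ (Fin d))
    (hvar : 1 / ((d : ℝ) * n) * ∑ i, ‖x i‖ ^ 2 = 1) :
    ∑ i, ∑ j, ‖x i - x j‖ ≤ 3 / 2 * n ^ 2 * √d := by
  have hd' : (0 : ℝ) < d := by exact_mod_cast hd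
  have hn' : (0 : ℝ) < n := by exact_mod_cast hn
  have h0 : ∑ i, ‖x i‖ ^ 2 = d * n := by
    field_simp at hvar; linarith
  have h1 := aux_variance x (fun _ => 1) (n : ℝ) (by simp) hn'
  have h2 : ∑ i, ∑ j, ‖x i - x j‖ ^ 2 ≤ 2 * n ^ 2 * d := by
    have h3 : ∑ j, (1 : ℝ) * (‖x j‖ ^ 2 - ‖∑ i, ((1 : ℝ) / n) • x i‖ ^ 2) ≤ d * n := by
      rw [← h0]
      refine Finset.sum_le_sum fun j _ => ?_
      rw [one_mul]
      linarith [sq_nonneg ‖∑ i, ((1 : ℝ) / n) • x i‖]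
    rw [h1] at h3
    simp only [← Finset.mul_sum, ← Finset.sum_div, mul_one] at h3
    rw [one_div, inv_mul_le_iff₀ hn'] at h3
    nlinarith
  have h4 := sq_sum_le_card_mul_sum_sq (s := (Finset.univ : Finset (Fin n × Fin n)))
    (f := fun p => ‖x p.1 - x p.2‖)
  simp only [Fintype.sum_prod_type, Finset.card_univ, Fintype.card_prod, Fintype.card_fin,
    Nat.cast_mul] at h4
  refine le_of_sq_le_sq (h4.trans ?_) (by positivity)
  rw [mul_pow, Real.sq_sqrt hd'.le]
  calc (n : ℝ) * n * ∑ i, ∑ j, ‖x i - x j‖ ^ 2 ≤ n * n * (2 * n ^ 2 * d) := by gcongr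
    _ ≤ _ := by
      have : (0 : ℝ) ≤ n ^ 4 * d := by positivity
      nlinarith

/-- primitive of the upper bound on `1 - λ` -/
noncomputable def Kprim (d n : ℕ) (x : Fin n → EuclideanSpace ℝ (Fin d)) (s : ℝ) : ℝ :=
  1 / ((d : ℝ) * n) * ∑ i, ∑ j, (‖x i - x j‖ ^ 2 / 2) *
    ∫ u in (0 : ℝ)..s, Real.exp (-(‖x i - x j‖ ^ 2 / 8) * u ^ 2)

lemma Kprim_deriv (d n : ℕ) (x : Fin n → EuclideanSpace ℝ (Fin d)) (s : ℝ) :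
    HasDerivAt (Kprim d n x) (1 / ((d : ℝ) * n) *
      ∑ i, ∑ j, Real.exp (-(‖x i - x j‖ ^ 2 / 8) * s ^ 2) * (‖x i - x j‖ ^ 2 / 2)) s := by
  unfold Kprim
  refine HasDerivAt.const_mul _ (HasDerivAt.fun_sum fun i _ => HasDerivAt.fun_sum fun j _ => ?_)
  rw [mul_comm (rexp _)]
  refine HasDerivAt.const_mul _ ?_
  have hc : Continuous (fun u : ℝ => Real.exp (-(‖x i - x j‖ ^ 2 / 8) * u ^ 2)) := by fun_prop
  exact intervalIntegral.integral_hasDerivAt_right (hc.intervalIntegrable _ _)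
    (hc.stronglyMeasurableAtFilter _ _) hc.continuousAt

lemma Kprim_nonneg (d n : ℕ) (x : Fin n → EuclideanSpace ℝ (Fin d)) {s : ℝ} (hs : 0 ≤ s) :
    0 ≤ Kprim d n x s := by
  refine mul_nonneg (by positivity) (Finset.sum_nonneg fun i _ => Finset.sum_nonneg fun j _ =>
    mul_nonneg (by positivity) (intervalIntegral.integral_nonneg hs fun u _ => (Real.exp_pos _).le))

lemma Kprim_le (d n : ℕ) (hd : 1 ≤ d) (hn : 1 ≤ n) (x : Fin n → EuclideanSpace ℝ (Fin d))
    (hvar : 1 / ((d : ℝ) * n) * ∑ i, ‖x i‖ ^ 2 = 1) {s : ℝ} (hs : 0 ≤ s) :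
    Kprim d n x s ≤ 3 * n / √d := by
  have hd' : (0 : ℝ) < d := by exact_mod_cast hd
  have hn' : (0 : ℝ) < n := by exact_mod_cast hn
  have h1 : Kprim d n x s ≤ 1 / ((d : ℝ) * n) * (2 * ∑ i, ∑ j, ‖x i - x j‖) := by
    unfold Kprim
    simp only [Finset.mul_sum (a := (2 : ℝ))]
    refine mul_le_mul_of_nonneg_left (Finset.sum_le_sum fun i _ => Finset.sum_le_sum fun j _ =>
      gauss_prim _ _ (norm_nonneg _) hs) (by positivity)
  refine h1.trans ?_
  calc _ ≤ 1 / ((d : ℝ) * n) * (2 * (3 / 2 * n ^ 2 * √d)) := by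
        gcongr; exact sum_dist d n hd hn x hvar
    _ = 3 * n * (√d / d) := by field_simp
    _ = 3 * n / √d := by rw [Real.sqrt_div_self']; ring

/-- Corollary 4.4: the Cond-OT scheduler `(t, 1−t)` is asymptotically kinetic optimal:
for any admissible scheduler `(a, m)` with Sobolev norms bounded by `M ≥ 1` and finite
kinetic energy, `E(Cond-OT) ≤ E(a,m) + 6 M² n / √d`. -/
theorem condOT_asymptotically_kinetic_optimal (d n : ℕ) (hd : 1 ≤ d) (hn : 1 ≤ n)
    (x : Fin n → EuclideanSpace ℝ (Fin d))
    (hmean : (n : ℝ)⁻¹ • ∑ i, x i = 0)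
    (hvar : 1 / ((d : ℝ) * n) * ∑ i, ‖x i‖ ^ 2 = 1)
    (a m : ℝ → ℝ) (M : ℝ) (hM : 1 ≤ M)
    (ha_nonneg : ∀ t ∈ Set.Icc (0 : ℝ) 1, 0 ≤ a t)
    (hm_nonneg : ∀ t ∈ Set.Icc (0 : ℝ) 1, 0 ≤ m t)
    (ha_cont : ContinuousOn a (Set.Icc 0 1))
    (hm_cont : ContinuousOn m (Set.Icc 0 1))
    (ha_smooth : ContDiffOn ℝ (⊤ : ℕ∞) a (Set.Ioo 0 1))
    (hm_smooth : ContDiffOn ℝ (⊤ : ℕ∞) m (Set.Ioo 0 1))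
    (ha0 : a 0 = 0) (ha1 : a 1 = 1) (hm0 : m 0 = 1) (hm1 : m 1 = 0)
    (hmono : StrictMonoOn (fun t => a t / m t) (Set.Ioo 0 1))
    (haM : ∀ t ∈ Set.Icc (0 : ℝ) 1, |a t| ≤ M)
    (haM' : ∀ t ∈ Set.Ioo (0 : ℝ) 1, |deriv a t| ≤ M)
    (hmM : ∀ t ∈ Set.Icc (0 : ℝ) 1, |m t| ≤ M)
    (hmM' : ∀ t ∈ Set.Ioo (0 : ℝ) 1, |deriv m t| ≤ M)
    (hfin1 : IntervalIntegrable (fun t => (deriv a t) ^ 2 + (deriv m t) ^ 2)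
      MeasureTheory.volume 0 1)
    (hfin2 : IntervalIntegrable
      (fun t => (deriv a t - a t * deriv m t / m t) ^ 2 * (1 - lamSep d n x (a t / m t)))
      MeasureTheory.volume 0 1) :
    KE d n x (fun t => t) (fun t => 1 - t) ≤ KE d n x a m + 6 * M ^ 2 * n / Real.sqrt d := by
  have hmpos : ∀ t ∈ Set.Ioo (0 : ℝ) 1, 0 < m t ∧ 0 < a t := by
    intro t ht
    have ht2 : t / 2 ∈ Set.Ioo (0 : ℝ) 1 := ⟨by linarith [ht.1], by linarith [ht.1, ht.2]⟩
    have h := hmono ht2 ht (by linarith [ht.1])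
    have h0 : 0 ≤ a (t / 2) / m (t / 2) :=
      div_nonneg (ha_nonneg _ ⟨ht2.1.le, ht2.2.le⟩) (hm_nonneg _ ⟨ht2.1.le, ht2.2.le⟩)
    have hp : 0 < a t / m t := lt_of_le_of_lt h0 h
    have hm' := hm_nonneg t ⟨ht.1.le, ht.2.le⟩
    have ha' := ha_nonneg t ⟨ht.1.le, ht.2.le⟩
    refine ⟨lt_of_le_of_ne hm' fun h => ?_, lt_of_le_of_ne ha' fun h => ?_⟩
    · rw [← h, div_zero] at hp; exact lt_irrefl _ hp
    · rw [← h, zero_div] at hp; exact lt_irrefl _ hp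
  have hda : ∀ t ∈ Set.Ioo (0 : ℝ) 1, HasDerivAt a (deriv a t) t := fun t ht =>
    ((ha_smooth.differentiableOn (by simp)).differentiableAt (isOpen_Ioo.mem_nhds ht)).hasDerivAt
  have hdm : ∀ t ∈ Set.Ioo (0 : ℝ) 1, HasDerivAt m (deriv m t) t := fun t ht =>
    ((hm_smooth.differentiableOn (by simp)).differentiableAt (isOpen_Ioo.mem_nhds ht)).hasDerivAt
  -- kinetic part of `(a, m)`
  have hk : 2 ≤ ∫ t in (0 : ℝ)..1, ((deriv a t) ^ 2 + (deriv m t) ^ 2) := by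
    have h := intervalIntegral.sub_le_integral_of_hasDeriv_right_of_le
      (g := fun t => 2 * a t - 2 * m t - 2 * t) (g' := fun t => 2 * deriv a t - 2 * deriv m t - 2 * 1)
      (φ := fun t => (deriv a t) ^ 2 + (deriv m t) ^ 2) (zero_le_one (α := ℝ)) (by fun_prop)
      (fun t ht => ((((hda t ht).const_mul 2).sub ((hdm t ht).const_mul 2)).sub
        ((hasDerivAt_id' t).const_mul 2)).hasDerivWithinAt)
      ((intervalIntegrable_iff_integrableOn_Icc_of_le zero_le_one).1 hfin1)
      (fun t ht => by nlinarith [sq_nonneg (deriv a t - 1), sq_nonneg (deriv m t + 1)])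
    simp only [ha0, ha1, hm0, hm1] at h
    linarith
  -- Cond-OT
  have hcond : KE d n x (fun t => t) (fun t => 1 - t) ≤ 2 := by
    unfold KE
    have h1 : ∀ t : ℝ, deriv (fun t : ℝ => 1 - t) t = -1 := fun t =>
      ((hasDerivAt_id' t).const_sub 1).deriv
    have h2 : 0 ≤ ∫ t in (0 : ℝ)..1, (deriv (fun t : ℝ => t) t - t * deriv (fun t : ℝ => 1 - t) t
        / (1 - t)) ^ 2 * (1 - lamSep d n x (t / (1 - t))) := by
      rw [intervalIntegral.integral_of_le zero_le_one, integral_Ioc_eq_integral_Ioo]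
      refine setIntegral_nonneg measurableSet_Ioo fun t ht => mul_nonneg (sq_nonneg _) ?_
      exact (lam_bounds d n hn x hvar (div_pos ht.1 (by linarith [ht.2]))).1
    have h3 : ∫ t in (0 : ℝ)..1, ((deriv (fun t : ℝ => t) t) ^ 2
        + (deriv (fun t : ℝ => 1 - t) t) ^ 2) = 2 := by
      simp only [h1, deriv_id'']
      norm_num
    rw [h3]
    linarith
  -- main bound
  have hC : (∫ t in (0 : ℝ)..1, (deriv a t - a t * deriv m t / m t) ^ 2 *
      (1 - lamSep d n x (a t / m t))) ≤ 6 * M ^ 2 * n / √d := by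
    set f := fun t => (deriv a t - a t * deriv m t / m t) ^ 2 * (1 - lamSep d n x (a t / m t)) with hf
    have hsd : ∀ t ∈ Set.Ioo (0 : ℝ) 1, HasDerivAt (fun t => a t / m t)
        ((deriv a t * m t - a t * deriv m t) / m t ^ 2) t := fun t ht =>
      (hda t ht).div (hdm t ht) (hmpos t ht).1.ne'
    have hsn : ∀ t ∈ Set.Ioo (0 : ℝ) 1, 0 ≤ (deriv a t * m t - a t * deriv m t) / m t ^ 2 := by
      intro t ht
      have h := hmono.monotoneOn.derivWithin_nonneg (x := t)
      rwa [derivWithin_of_isOpen isOpen_Ioo ht, (hsd t ht).deriv] at h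
    have hsub : ∀ u v : ℝ, 0 < u → u ≤ v → v < 1 → ∫ t in u..v, f t ≤ 6 * M ^ 2 * n / √d := by
      intro u v hu huv hv
      have hI : ∀ t ∈ Set.Icc u v, t ∈ Set.Ioo (0 : ℝ) 1 := fun t ht =>
        ⟨hu.trans_le ht.1, ht.2.trans_lt hv⟩
      have hg : ∀ t ∈ Set.Icc u v, HasDerivAt (fun t => 2 * M ^ 2 * Kprim d n x (a t / m t)) _ t :=
        fun t ht => ((Kprim_deriv d n x (a t / m t)).comp t (hsd t (hI t ht))).const_mul (2 * M ^ 2)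
      have h := intervalIntegral.integral_le_sub_of_hasDeriv_right_of_le (φ := f) huv
        (fun t ht => (hg t ht).continuousAt.continuousWithinAt)
        (fun t ht => (hg t (Set.Ioo_subset_Icc_self ht)).hasDerivWithinAt)
        (((intervalIntegrable_iff_integrableOn_Icc_of_le zero_le_one).1 hfin2).mono_set
          (Set.Icc_subset_Icc hu.le hv.le)) (fun t ht' => by
          have ht := hI t (Set.Ioo_subset_Icc_self ht')
          obtain ⟨hm', ha'⟩ := hmpos t ht
          obtain ⟨hl0, hl1⟩ := lam_bounds d n hn x hvar (div_pos ha' hm')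
          have hs' := hsn t ht
          have hb : (deriv a t - a t * deriv m t / m t) ^ 2 =
              (deriv a t * m t - a t * deriv m t) *
                ((deriv a t * m t - a t * deriv m t) / m t ^ 2) := by
            field_simp
          have hW : deriv a t * m t - a t * deriv m t ≤ 2 * M ^ 2 := by
            have tc : t ∈ Set.Icc (0 : ℝ) 1 := ⟨ht.1.le, ht.2.le⟩
            have e1 : |deriv a t * m t| ≤ M * M := by
              rw [abs_mul]
              exact mul_le_mul (haM' t ht) (hmM t tc) (abs_nonneg _) (by linarith)
            have e2 : |a t * deriv m t| ≤ M * M := by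
              rw [abs_mul]
              exact mul_le_mul (haM t tc) (hmM' t ht) (abs_nonneg _) (by linarith)
            have := le_abs_self (deriv a t * m t)
            have := neg_abs_le (a t * deriv m t)
            nlinarith
          have hb2 : (deriv a t - a t * deriv m t / m t) ^ 2 ≤
              2 * M ^ 2 * ((deriv a t * m t - a t * deriv m t) / m t ^ 2) := by
            rw [hb]; exact mul_le_mul_of_nonneg_right hW hs'
          calc f t ≤ _ := mul_le_mul hb2 hl1 hl0 (by positivity)
            _ = _ := by ring)
      refine h.trans ?_
      obtain ⟨hmu, hau⟩ := hmpos u (hI u ⟨le_rfl, huv⟩)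
      obtain ⟨hmv, hav⟩ := hmpos v (hI v ⟨huv, le_rfl⟩)
      have k1 := Kprim_nonneg d n x (div_pos hau hmu).le
      have k2 := Kprim_le d n hd hn x hvar (div_pos hav hmv).le
      have hM2 : 0 ≤ 2 * M ^ 2 := by positivity
      calc _ ≤ 2 * M ^ 2 * Kprim d n x (a v / m v) := sub_le_self _ (mul_nonneg hM2 k1)
        _ ≤ 2 * M ^ 2 * (3 * n / √d) := mul_le_mul_of_nonneg_left k2 hM2
        _ = _ := by ring
    have hF : ContinuousOn (fun u => ∫ t in (0 : ℝ)..u, f t) (Set.Icc 0 1) := by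
      have := intervalIntegral.continuousOn_primitive_interval' hfin2 (a := 0) (by simp)
      rwa [Set.uIcc_of_le zero_le_one] at this
    have hh : ContinuousOn (fun e : ℝ => (∫ t in (0 : ℝ)..(1 - e), f t) - ∫ t in (0 : ℝ)..e, f t)
        (Set.Icc 0 (1 / 2)) := by
      refine ContinuousOn.sub (hF.comp (f := fun e : ℝ => 1 - e) (by fun_prop) ?_) (hF.mono ?_)
      · intro e he; exact ⟨by linarith [he.2], by linarith [he.1]⟩
      · intro e he; exact ⟨he.1, by linarith [he.2]⟩
    have h0 := ((hh 0 (by norm_num)).mono Set.Ioo_subset_Icc_self).tendsto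
    simp only [sub_zero, intervalIntegral.integral_same] at h0
    have : (nhdsWithin (0 : ℝ) (Set.Ioo 0 (1 / 2))).NeBot :=
      left_nhdsWithin_Ioo_neBot (by norm_num)
    refine le_of_tendsto h0 ?_
    filter_upwards [self_mem_nhdsWithin] with e he
    have hi : ∀ y ∈ Set.Icc (0 : ℝ) 1, IntervalIntegrable f volume 0 y := fun y hy =>
      hfin2.mono_set (by
        rw [Set.uIcc_of_le hy.1, Set.uIcc_of_le zero_le_one]; exact Set.Icc_subset_Icc le_rfl hy.2)
    rw [intervalIntegral.integral_interval_sub_left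
      (hi _ ⟨by linarith [he.2], by linarith [he.1]⟩) (hi _ ⟨he.1.le, by linarith [he.2]⟩)]
    exact hsub e (1 - e) he.1 (by linarith [he.2]) (by linarith [he.1])
  have : KE d n x a m = (∫ t in (0 : ℝ)..1, ((deriv a t) ^ 2 + (deriv m t) ^ 2)) -
    ∫ t in (0 : ℝ)..1,
      (deriv a t - a t * deriv m t / m t) ^ 2 * (1 - lamSep d n x (a t / m t)) := rfl
  rw [this]
  linarith
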